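/- Let A be a C*-algebra with the Global Glimm Property. Then the following are equivalent: (i) there exist m, n ∈ ℕ such that wdiv_{2m}(m·x) ≤ n for every x ∈ Cu(A); (ii) there exist m, n ∈ ℕ such that wdiv_{2m}(m·x) ≤ n for every strongly soft x ∈ Cu(A). -/

import Mathlib

/-!
Common definitions: abstract Cuntz semigroups, divisibility, and C*-algebra notions
(nowhere scatteredness, σ-unitality, etc.) used to formalize the statements.
-/

open scoped MultiplierAlgebra ENNReal
open Filter Topology

noncomputable section

universe uu vv

/-- The (sequential) way-below relation `x ≪ y` (compact containment) in a partially
ordered set: whenever an increasing sequence has a supremum lying above `y`, some term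
of the sequence already lies above `x`. -/
def WayBelow {S : Type*} [PartialOrder S] (x y : S) : Prop :=
  ∀ f : ℕ → S, Monotone f → ∀ s : S, IsLUB (Set.range f) s → y ≤ s → ∃ n, x ≤ f n

/-- An abstract Cuntz semigroup (`Cu`-semigroup): a positively ordered abelian monoid in
which every increasing sequence has a supremum, every element is the supremum of a
`≪`-increasing sequence, addition preserves `≪`, and which satisfies the standard
axioms (O5) (almost algebraic order) and (O6) (almost Riesz decomposition), as well as
the existence of infima with idempotents `∞y = sup_n n•y` (all of these hold in the
Cuntz semigroup of any C*-algebra). -/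
class CuSemigroup (S : Type*) extends AddCommMonoid S, PartialOrder S where
  add_le_add' : ∀ a b : S, a ≤ b → ∀ c : S, c + a ≤ c + b
  zero_le' : ∀ x : S, 0 ≤ x
  exists_isLUB : ∀ f : ℕ → S, Monotone f → ∃ s : S, IsLUB (Set.range f) s
  exists_waybelow_seq : ∀ x : S, ∃ f : ℕ → S, Monotone f ∧
    (∀ n, WayBelow (f n) (f (n + 1))) ∧ IsLUB (Set.range f) x
  waybelow_add : ∀ {x y z w : S}, WayBelow x y → WayBelow z w → WayBelow (x + z) (y + w)
  /-- axiom (O5) -/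
  almost_algebraic : ∀ x' x y' y z : S, WayBelow x' x → WayBelow y' y → x + y ≤ z →
    ∃ c : S, y' ≤ c ∧ x' + c ≤ z ∧ z ≤ x + c
  /-- axiom (O6) -/
  almost_riesz : ∀ x' x y z : S, WayBelow x' x → x ≤ y + z →
    ∃ v w : S, v ≤ x ∧ v ≤ y ∧ w ≤ x ∧ w ≤ z ∧ x' ≤ v + w
  /-- `infty y = ∞·y = sup_n n•y` -/
  infty : S → S
  isLUB_infty : ∀ y : S, IsLUB (Set.range fun n : ℕ => n • y) (infty y)
  /-- the infimum `x ⊓ ∞y`, which exists in the Cuntz semigroup of any C*-algebra -/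
  meetInfty : S → S → S
  isGLB_meetInfty : ∀ x y : S, IsGLB {x, infty y} (meetInfty x y)

namespace CuDiv

variable {S : Type*} [CuSemigroup S]

/-- `x` is weakly `(m, n)`-divisible. -/
def IsWeaklyDivisible (m n : ℕ) (x : S) : Prop :=
  ∀ x' : S, WayBelow x' x → ∃ y : Fin n → S, x' ≤ ∑ j, y j ∧ ∀ j, m • y j ≤ x

/-- `x` is `(m, n)`-divisible. -/
def IsDivisible (m n : ℕ) (x : S) : Prop :=
  ∀ x' : S, WayBelow x' x → ∃ y : S, x' ≤ n • y ∧ m • y ≤ x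

/-- `x` is weakly `(m, ω)`-divisible. -/
def IsWeaklyOmegaDivisible (m : ℕ) (x : S) : Prop :=
  ∀ x' : S, WayBelow x' x → ∃ (n : ℕ) (y : Fin n → S), x' ≤ ∑ j, y j ∧ ∀ j, m • y j ≤ x

/-- `x` is `(m, ω)`-divisible. -/
def IsOmegaDivisible (m : ℕ) (x : S) : Prop :=
  ∀ x' : S, WayBelow x' x → ∃ (y : S) (n : ℕ), x' ≤ n • y ∧ m • y ≤ x

/-- `wdiv m x` is the least positive integer `n` such that `x` is weakly
`(m,n)`-divisible, and `∞` if there is no such `n`. -/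
def wdiv (m : ℕ) (x : S) : ℕ∞ :=
  sInf {N : ℕ∞ | ∃ n : ℕ, 1 ≤ n ∧ N = n ∧ IsWeaklyDivisible m n x}

/-- `Div m x` is the least positive integer `n` such that `x` is `(m,n)`-divisible,
and `∞` if there is no such `n`. -/
def Div (m : ℕ) (x : S) : ℕ∞ :=
  sInf {N : ℕ∞ | ∃ n : ℕ, 1 ≤ n ∧ N = n ∧ IsDivisible m n x}

/-- An element `x` is strongly soft if for every `x' ≪ x` there is `t` with
`x' + t ≤ x ≤ ∞t`. -/
def StronglySoft (x : S) : Prop :=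
  ∀ x' : S, WayBelow x' x → ∃ t : S, x' + t ≤ x ∧ x ≤ CuSemigroup.infty t

/-- The Cuntz semigroup characterization of the Global Glimm Property: every element is
`(m, ω)`-divisible for every `m`. -/
def GlobalGlimm (S : Type*) [CuSemigroup S] : Prop :=
  ∀ (m : ℕ) (x : S), IsOmegaDivisible m x

/-- `Cu(A)` is left-soft separative. -/
def LeftSoftSeparative (S : Type*) [CuSemigroup S] : Prop :=
  ∀ x y t : S, StronglySoft x → WayBelow (x + t) (y + t) →
    WayBelow t (CuSemigroup.infty y) → WayBelow t (CuSemigroup.infty x) → WayBelow x y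

/-- `Cu(A)` is weakly cancellative. -/
def WeaklyCancellative (S : Type*) [CuSemigroup S] : Prop :=
  ∀ x y z : S, WayBelow (x + z) (y + z) → WayBelow x y

/-- `Cu(A)` has covering dimension zero. -/
def CoveringDimZero (S : Type*) [CuSemigroup S] : Prop :=
  ∀ x' x y₁ y₂ : S, WayBelow x' x → WayBelow x (y₁ + y₂) →
    ∃ z₁ z₂ : S, z₁ ≤ y₁ ∧ z₂ ≤ y₂ ∧ x' ≤ z₁ + z₂ ∧ z₁ + z₂ ≤ x

end CuDiv

/-- A functional on a Cuntz semigroup: an additive, order preserving map to `ℝ≥0∞`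
preserving suprema of increasing sequences.  (By Elliott–Robert–Santiago, the
functionals on `Cu(A)` are exactly those induced by the lower semicontinuous
2-quasitraces on `A ⊗ K`.) -/
structure CuFunctional (S : Type*) [CuSemigroup S] where
  toFun : S → ℝ≥0∞
  map_zero' : toFun 0 = 0
  map_add' : ∀ x y : S, toFun (x + y) = toFun x + toFun y
  mono' : ∀ x y : S, x ≤ y → toFun x ≤ toFun y
  sup' : ∀ f : ℕ → S, Monotone f → ∀ s : S, IsLUB (Set.range f) s →
    toFun s = ⨆ n, toFun (f n)

instance {S : Type*} [CuSemigroup S] : CoeFun (CuFunctional S) fun _ => S → ℝ≥0∞ :=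
  ⟨CuFunctional.toFun⟩

namespace CuDiv

variable {S : Type*} [CuSemigroup S]

/-- `x <ₛ y` : there is `γ < 1` with `λ(x) ≤ γ·λ(y)` for every functional `λ`. -/
def FunctionalLT (x y : S) : Prop :=
  ∃ γ : ℝ≥0∞, γ < 1 ∧ ∀ lam : CuFunctional S, lam x ≤ γ * lam y

/-- `A` has `k`-comparison (stated on `Cu(A)`). -/
def KComparison (S : Type*) [CuSemigroup S] (k : ℕ) : Prop :=
  ∀ (x : S) (b : Fin (k + 1) → S), (∀ i, FunctionalLT x (b i)) → x ≤ ∑ i, b i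

/-- `A` has strict comparison (stated on `Cu(A)`, via functionals, which correspond to
the lower semicontinuous 2-quasitraces). -/
def StrictComparison (S : Type*) [CuSemigroup S] : Prop :=
  ∀ x y : S, FunctionalLT x y → x ≤ y

/-- The natural topology on the cone `F(Cu(A))` of functionals. -/
def functionalTopology (S : Type*) [CuSemigroup S] : TopologicalSpace (CuFunctional S) :=
  TopologicalSpace.generateFrom
    ({U | ∃ (x : S) (r : ℝ≥0∞), U = {lam : CuFunctional S | r < lam x}} ∪
      {U | ∃ (x' x : S) (r : ℝ≥0∞), WayBelow x' x ∧ U = {lam : CuFunctional S | lam x' < r}})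

/-- A lower semicontinuous affine function on the cone of functionals of `Cu(A)`,
i.e. an element of `L(F(Cu(A)))`. -/
def IsLscAffine (F : CuFunctional S → ℝ≥0∞) : Prop :=
  (letI := functionalTopology S; LowerSemicontinuous F) ∧
    (∀ lam mu nu : CuFunctional S, (∀ x, nu x = lam x + mu x) → F nu = F lam + F mu) ∧
    (∀ (r : ℝ≥0∞) (lam nu : CuFunctional S), (∀ x, nu x = r * lam x) → F nu = r * F lam)

/-- The rank map of `Cu(A)` is surjective: every lower semicontinuous affine function on
the cone of functionals is realized as the rank function `λ ↦ λ(x)` of an element. -/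
def SurjectiveRankMap (S : Type*) [CuSemigroup S] : Prop :=
  ∀ F : CuFunctional S → ℝ≥0∞, IsLscAffine F → ∃ y : S, ∀ lam : CuFunctional S, lam y = F lam

end CuDiv

/-! ### C*-algebra notions -/

section CStar

variable {B : Type*} [NonUnitalCStarAlgebra B]

/-- Positivity in a C*-algebra: `a` is positive iff it is of the form `star b * b`. -/
def CStarNonneg (a : B) : Prop := ∃ b : B, a = star b * b

/-- Cuntz subequivalence `a ≼ b` : `a = lim_n rₙ b rₙ*`. -/
def CuntzBelow (a b : B) : Prop :=
  ∃ r : ℕ → B, Tendsto (fun n => r n * b * star (r n)) atTop (𝓝 a)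

/-- Cuntz equivalence. -/
def CuntzEquiv (a b : B) : Prop := CuntzBelow a b ∧ CuntzBelow b a

/-- `A` is σ-unital: it has a countable (norm-bounded, positive) approximate unit. -/
def SigmaUnital (A : Type*) [NonUnitalCStarAlgebra A] : Prop :=
  ∃ e : ℕ → A, (∀ n, CStarNonneg (e n) ∧ ‖e n‖ ≤ 1) ∧
    ∀ a : A, Tendsto (fun n => e n * a) atTop (𝓝 a) ∧ Tendsto (fun n => a * e n) atTop (𝓝 a)

end CStar

/-- A closed two-sided (automatically star-closed) ideal of a C*-algebra. -/
structure ClosedTwoSidedIdealC (A : Type*) [NonUnitalCStarAlgebra A] where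
  carrier : NonUnitalStarSubalgebra ℂ A
  isClosed : IsClosed (carrier : Set A)
  mul_mem_left : ∀ a : A, ∀ x ∈ carrier, a * x ∈ carrier
  mul_mem_right : ∀ a : A, ∀ x ∈ carrier, x * a ∈ carrier

section Reps

variable {A : Type*} [NonUnitalCStarAlgebra A]
variable {H : Type*} [NormedAddCommGroup H] [InnerProductSpace ℂ H] [CompleteSpace H]

/-- A (topologically) irreducible representation of `A` on a Hilbert space `H`. -/
def IsIrreducibleRep (π : A →⋆ₙₐ[ℂ] (H →L[ℂ] H)) : Prop :=
  (∃ a : A, π a ≠ 0) ∧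
    ∀ K : Submodule ℂ H, IsClosed (K : Set H) → (∀ a : A, ∀ v ∈ K, π a v ∈ K) →
      K = ⊥ ∨ K = ⊤

end Reps

/-- `A` has a nonzero elementary ideal-quotient `J/I`, expressed via a surjection of a
closed two-sided ideal `J` of `A` onto the algebra of compact operators on a Hilbert
space (the kernel `I` of such a `*`-homomorphism is automatically a closed two-sided
ideal of `A`, and conversely any nonzero elementary ideal-quotient arises this way). -/
def HasNonzeroElementaryIdealQuotient (A : Type*) [NonUnitalCStarAlgebra A] : Prop :=
  ∃ (J : ClosedTwoSidedIdealC A) (H : Type) (_ : NormedAddCommGroup H)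
    (_ : InnerProductSpace ℂ H) (_ : CompleteSpace H)
    (ψ : J.carrier →⋆ₙₐ[ℂ] (H →L[ℂ] H)),
      Set.range ψ = {T : H →L[ℂ] H | IsCompactOperator ⇑T} ∧ ∃ x, ψ x ≠ 0

/-- A C*-algebra is nowhere scattered if no ideal-quotient of it is nonzero and
elementary. -/
def NowhereScattered (A : Type*) [NonUnitalCStarAlgebra A] : Prop :=
  ¬ HasNonzeroElementaryIdealQuotient A

/-- A C*-algebra is elementary if it is isomorphic to the algebra of compact operators
on some Hilbert space. -/
def IsElementaryCStar (A : Type*) [NonUnitalCStarAlgebra A] : Prop :=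
  ∃ (H : Type) (_ : NormedAddCommGroup H) (_ : InnerProductSpace ℂ H) (_ : CompleteSpace H)
    (ψ : A →⋆ₙₐ[ℂ] (H →L[ℂ] H)),
      Function.Injective ψ ∧ Set.range ψ = {T : H →L[ℂ] H | IsCompactOperator ⇑T}

/-- A C*-algebra is simple if it is nonzero and has no nontrivial closed two-sided
ideals. -/
def IsSimpleCStar (A : Type*) [NonUnitalCStarAlgebra A] : Prop :=
  (∃ a : A, a ≠ 0) ∧
    ∀ J : ClosedTwoSidedIdealC A, (J.carrier : Set A) = {0} ∨ (J.carrier : Set A) = Set.univ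

/-- Real rank zero: the invertible self-adjoint elements are dense in the self-adjoint
part of the minimal unitization. -/
def RealRankZero (A : Type*) [NonUnitalCStarAlgebra A] : Prop :=
  ∀ x : Unitization ℂ A, IsSelfAdjoint x →
    x ∈ closure {y : Unitization ℂ A | IsSelfAdjoint y ∧ IsUnit y}

/-- Stable rank one: the invertible elements are dense in the minimal unitization. -/
def StableRankOne (A : Type*) [NonUnitalCStarAlgebra A] : Prop :=
  ∀ x : Unitization ℂ A, x ∈ closure {y : Unitization ℂ A | IsUnit y}

section CP

variable {A B : Type*} [NonUnitalCStarAlgebra A] [NonUnitalCStarAlgebra B]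

/-- A linear map between C*-algebras is completely positive if all of its matrix
amplifications preserve positivity. -/
def IsCompletelyPositive (φ : A →ₗ[ℂ] B) : Prop :=
  ∀ (n : ℕ) (a : Matrix (Fin n) (Fin n) A), (∃ b : Matrix (Fin n) (Fin n) A, a = star b * b) →
    ∃ c : Matrix (Fin n) (Fin n) B, a.map ⇑φ = star c * c

/-- A completely positive contractive (c.p.c.) map. -/
def IsCPC (φ : A →ₗ[ℂ] B) : Prop :=
  IsCompletelyPositive φ ∧ ∀ a : A, ‖φ a‖ ≤ ‖a‖

/-- A map between C*-algebras has order zero if it preserves orthogonality of positive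
elements. -/
def IsOrderZero (φ : A →ₗ[ℂ] B) : Prop :=
  ∀ a b : A, CStarNonneg a → CStarNonneg b → a * b = 0 → φ a * φ b = 0

end CP

/-- `A` has nuclear dimension at most `k`: there are c.p.c. approximations of the
identity through finite dimensional C*-algebras in which the downwards maps are sums of
`k+1` c.p.c. order zero maps. -/
def NuclearDimLE (A : Type*) [NonUnitalCStarAlgebra A] (k : ℕ) : Prop :=
  ∀ (F : Finset A) (ε : ℝ), 0 < ε →
    ∃ (Fd : Type) (_ : NonUnitalCStarAlgebra Fd) (_ : FiniteDimensional ℂ Fd)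
      (ψ : A →ₗ[ℂ] Fd) (φ : Fin (k + 1) → (Fd →ₗ[ℂ] A)),
        IsCPC ψ ∧ (∀ i, IsCPC (φ i) ∧ IsOrderZero (φ i)) ∧
        ∀ a ∈ F, ‖(∑ i, φ i (ψ a)) - a‖ ≤ ε

section Prim

variable (A : Type*) [NonUnitalCStarAlgebra A]

/-- A primitive ideal: the kernel of an irreducible representation. -/
def IsPrimitiveIdeal {A : Type*} [NonUnitalCStarAlgebra A] (J : ClosedTwoSidedIdealC A) : Prop :=
  ∃ (H : Type) (_ : NormedAddCommGroup H) (_ : InnerProductSpace ℂ H) (_ : CompleteSpace H)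
    (π : A →⋆ₙₐ[ℂ] (H →L[ℂ] H)),
      IsIrreducibleRep π ∧ ∀ a : A, a ∈ J.carrier ↔ π a = 0

/-- The primitive ideal space of `A`. -/
def PrimIdealSpace := {J : ClosedTwoSidedIdealC A // IsPrimitiveIdeal J}

/-- The hull-kernel (Jacobson) topology on the primitive ideal space. -/
instance : TopologicalSpace (PrimIdealSpace A) :=
  TopologicalSpace.generateFrom {U | ∃ a : A, U = {P : PrimIdealSpace A | a ∉ P.1.carrier}}

/-- `A` has topological dimension zero: the primitive ideal space has a basis of
compact open sets. -/
def TopDimZero : Prop :=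
  ∃ 𝒷 : Set (Set (PrimIdealSpace A)), TopologicalSpace.IsTopologicalBasis 𝒷 ∧
    ∀ U ∈ 𝒷, IsCompact U ∧ IsOpen U

end Prim

section Proj

variable {B : Type*} [NonUnitalCStarAlgebra B]

/-- A projection in a C*-algebra. -/
def IsProjectionElem (p : B) : Prop := IsSelfAdjoint p ∧ p * p = p

/-- `B` contains an infinite projection: a projection which is Murray-von Neumann
equivalent to a proper subprojection of itself. -/
def HasInfiniteProjection (B : Type*) [NonUnitalCStarAlgebra B] : Prop :=
  ∃ p v : B, IsProjectionElem p ∧ star v * v = p ∧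
    p * (v * star v) = v * star v ∧ v * star v ≠ p

end Proj

/-! ### The Cuntz semigroup of a C*-algebra -/

/-- Padding a matrix by one extra row and column of zeros. -/
def matPad {A : Type*} [Zero A] {n : ℕ} (a : Matrix (Fin n) (Fin n) A) :
    Matrix (Fin (n + 1)) (Fin (n + 1)) A :=
  Matrix.of fun i j =>
    if h : (i : ℕ) < n ∧ (j : ℕ) < n then a ⟨i, h.1⟩ ⟨j, h.2⟩ else 0

/-- A witness that `S` is the Cuntz semigroup of the C*-algebra `A`: it provides a
stabilization `stab` of `A` (a model of `A ⊗ K`, described as the C*-completion of the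
union of the matrix algebras `Mₙ(A)`), together with the class map
`cls : (stab)₊ → S = Cu(A)` identifying `S` with the set of Cuntz equivalence classes of
positive elements of `A ⊗ K`, with order induced by Cuntz subequivalence, addition
induced by orthogonal (diagonal) addition, and with the compact containment relation
`≪` given by `x ≪ [a]` iff `x ≤ [(a - ε)₊]` for some `ε > 0`. -/
structure IsCuntzSemigroupOf (A : Type uu) [NonUnitalCStarAlgebra A]
    (S : Type vv) [CuSemigroup S] where
  stab : Type (max uu vv)
  [stabCStar : NonUnitalCStarAlgebra stab]
  matEmb : (n : ℕ) → (Matrix (Fin n) (Fin n) A →⋆ₙₐ[ℂ] stab)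
  matEmb_injective : ∀ n, Function.Injective (matEmb n)
  matEmb_compat : ∀ (n : ℕ) (a : Matrix (Fin n) (Fin n) A), matEmb (n + 1) (matPad a) = matEmb n a
  matEmb_dense : Dense (⋃ n, Set.range (matEmb n))
  cls : stab → S
  cls_zero : cls 0 = 0
  cls_surj : ∀ s : S, ∃ b : stab, CStarNonneg b ∧ cls b = s
  cls_le_iff : ∀ a b : stab, CStarNonneg a → CStarNonneg b → (cls a ≤ cls b ↔ CuntzBelow a b)
  cls_add_orth : ∀ a b : stab, CStarNonneg a → CStarNonneg b → a * b = 0 →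
    cls (a + b) = cls a + cls b
  exists_orth : ∀ a b : stab, CStarNonneg a → CStarNonneg b →
    ∃ a' b' : stab, CStarNonneg a' ∧ CStarNonneg b' ∧ a' * b' = 0 ∧
      cls a' = cls a ∧ cls b' = cls b
  waybelow_iff : ∀ (x : S) (a : stab), CStarNonneg a →
    (WayBelow x (cls a) ↔ ∃ ε : ℝ, 0 < ε ∧ x ≤ cls (cfcₙ (fun t : ℝ => max (t - ε) 0) a))

attribute [instance] IsCuntzSemigroupOf.stabCStar

/-- The Cuntz class `[a] ∈ Cu(A)` of an element `a` of `A` itself (via the canonical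
embedding `A ≅ M₁(A) ⊆ A ⊗ K`). -/
def IsCuntzSemigroupOf.clsA {A : Type*} [NonUnitalCStarAlgebra A] {S : Type*} [CuSemigroup S]
    (h : IsCuntzSemigroupOf A S) (a : A) : S :=
  h.cls (h.matEmb 1 (Matrix.of fun _ _ => a))

/-- `B` has a surjective rank map (every lower semicontinuous affine function on the
cone of functionals on `Cu(B)` is realized as a rank function). -/
def HasSurjectiveRankMap (B : Type*) [NonUnitalCStarAlgebra B] : Prop :=
  ∀ (S : Type) (inst : CuSemigroup S), IsCuntzSemigroupOf B S → CuDiv.SurjectiveRankMap S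

/-- The family of separable sub-C*-algebras of `A` having a surjective rank map. -/
def sepSurjRankFamily (A : Type*) [NonUnitalCStarAlgebra A] :
    Set (NonUnitalStarSubalgebra ℂ A) :=
  {B | ∃ _h : IsClosed (B : Set A),
    TopologicalSpace.SeparableSpace B ∧ HasSurjectiveRankMap B}

/-- The family of separable sub-C*-algebras of `A` with a surjective rank map is
σ-complete (closed under countable increasing unions) and cofinal (every separable
sub-C*-algebra is contained in a member). -/
def SepSurjRankFamilySigmaCompleteCofinal (A : Type*) [NonUnitalCStarAlgebra A] : Prop :=
  (∀ Bseq : ℕ → NonUnitalStarSubalgebra ℂ A, Monotone Bseq →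
    (∀ n, Bseq n ∈ sepSurjRankFamily A) →
      (⨆ n, Bseq n).topologicalClosure ∈ sepSurjRankFamily A) ∧
  (∀ C : NonUnitalStarSubalgebra ℂ A, IsClosed (C : Set A) →
    TopologicalSpace.SeparableSpace C → ∃ B ∈ sepSurjRankFamily A, C ≤ B)

end

instance CuSemigroup.isOrderedAddMonoid {S : Type*} [CuSemigroup S] : IsOrderedAddMonoid S where
  add_le_add_left a b h c := by
    rw [add_comm a, add_comm b]
    exact CuSemigroup.add_le_add' a b h c

namespace WayBelow

variable {S : Type*} [PartialOrder S] {x y z : S}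

theorem le (h : WayBelow x y) : x ≤ y := by
  obtain ⟨_, hn⟩ := h (fun _ => y) monotone_const y (by simp) le_rfl
  exact hn

theorem trans_le (h : WayBelow x y) (hyz : y ≤ z) : WayBelow x z :=
  fun f hf s hs hz => h f hf s hs (hyz.trans hz)

theorem of_le (hxy : x ≤ y) (h : WayBelow y z) : WayBelow x z := fun f hf s hs hz =>
  (h f hf s hs hz).imp fun _ hn => hxy.trans hn

end WayBelow

section CStar

variable {B : Type*} [NonUnitalCStarAlgebra B]

theorem CStarNonneg.isSelfAdjoint {a : B} (ha : CStarNonneg a) : IsSelfAdjoint a := by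
  obtain ⟨b, rfl⟩ := ha
  exact IsSelfAdjoint.star_mul_self b

theorem CStarNonneg.quasispectrum_nonneg {a : B} (ha : CStarNonneg a) {t : ℝ}
    (ht : t ∈ quasispectrum ℝ a) : 0 ≤ t := by
  let _ := CStarAlgebra.spectralOrder B
  have := CStarAlgebra.spectralOrderedRing B
  obtain ⟨b, rfl⟩ := ha
  exact quasispectrum_nonneg_of_nonneg _ (star_mul_self_nonneg b) t ht

/-- The cut-down `(a - ε)₊` is positive. -/
theorem CStarNonneg.cutdown {a : B} (ha : CStarNonneg a) {ε : ℝ} (hε : 0 < ε) :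
    CStarNonneg (cfcₙ (fun t : ℝ => max (t - ε) 0) a) := by
  have hsa := ha.isSelfAdjoint
  have h0 : √(max (0 - ε) 0) = 0 := by simp [hε.le]
  refine ⟨cfcₙ (fun t : ℝ => √(max (t - ε) 0)) a, ?_⟩
  rw [(cfcₙ_predicate (R := ℝ) (p := IsSelfAdjoint)
    (fun t : ℝ => √(max (t - ε) 0)) a).star_eq,
    ← cfcₙ_mul (fun t : ℝ => √(max (t - ε) 0)) (fun t : ℝ => √(max (t - ε) 0)) a
      (by fun_prop) h0 (by fun_prop) h0]
  congr 1
  funext t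
  exact (Real.mul_self_sqrt (le_max_right _ _)).symm

theorem CStarNonneg.norm_cutdown_sub_le {a : B} (ha : CStarNonneg a) {ε : ℝ} (hε : 0 < ε) :
    ‖cfcₙ (fun t : ℝ => max (t - ε) 0) a - a‖ ≤ ε := by
  have hsa := ha.isSelfAdjoint
  have h0 : max (0 - ε) 0 = 0 := by simp [hε.le]
  have h : cfcₙ (fun t : ℝ => max (t - ε) 0 - t) a =
      cfcₙ (fun t : ℝ => max (t - ε) 0) a - a := by
    rw [cfcₙ_sub (fun t : ℝ => max (t - ε) 0) (fun t => t) a (by fun_prop) h0 (by fun_prop) rfl,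
      cfcₙ_id' ℝ a]
  rw [← h]
  refine norm_cfcₙ_le fun t ht => ?_
  have ht0 := ha.quasispectrum_nonneg ht
  rw [Real.norm_eq_abs, abs_le]
  rcases max_cases (t - ε) 0 with ⟨h1, h2⟩ | ⟨h1, h2⟩ <;> rw [h1] <;> constructor <;> linarith

/-- Cut-downs of orthogonal positive elements are orthogonal. -/
theorem CStarNonneg.cutdown_mul_cutdown {a b : B} (ha : CStarNonneg a) (hb : CStarNonneg b)
    (hab : a * b = 0) {ε : ℝ} (hε : 0 < ε) :
    cfcₙ (fun t : ℝ => max (t - ε) 0) a * cfcₙ (fun t : ℝ => max (t - ε) 0) b = 0 := by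
  have hsa := ha.isSelfAdjoint
  have hsb := hb.isSelfAdjoint
  set g : ℝ → ℝ := fun t => max (t - ε) 0 / max t ε with hg
  have hpos : ∀ t, max t ε ≠ 0 := fun t => (lt_max_of_lt_right hε).ne'
  have hgc : Continuous g := by
    rw [hg]
    exact Continuous.div (by fun_prop) (by fun_prop) hpos
  have hg0 : g 0 = 0 := by simp [hg, hε.le]
  have hfg : ∀ t, max (t - ε) 0 = g t * t := by
    intro t
    rcases le_total t ε with h | h
    · simp [hg, h]
    · have : t ≠ 0 := (hε.trans_le h).ne'
      simp only [hg, max_eq_left h]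
      field_simp
  have hfa : cfcₙ (fun t : ℝ => max (t - ε) 0) a = cfcₙ g a * a := by
    rw [show cfcₙ g a * a = cfcₙ g a * cfcₙ (fun t : ℝ => t) a by rw [cfcₙ_id' ℝ a],
      ← cfcₙ_mul g (fun t => t) a hgc.continuousOn hg0 (by fun_prop) rfl]
    exact congrArg (cfcₙ · a) (funext hfg)
  have hfb : cfcₙ (fun t : ℝ => max (t - ε) 0) b = b * cfcₙ g b := by
    rw [show b * cfcₙ g b = cfcₙ (fun t : ℝ => t) b * cfcₙ g b by rw [cfcₙ_id' ℝ b],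
      ← cfcₙ_mul (fun t => t) g b (by fun_prop) rfl hgc.continuousOn hg0]
    exact congrArg (cfcₙ · b) (funext fun t => (hfg t).trans (mul_comm _ _))
  rw [hfa, hfb, mul_assoc, ← mul_assoc a, hab, zero_mul, mul_zero]

/-- The set of elements Cuntz below a fixed element is norm closed. -/
theorem CuntzBelow.of_forall_dist_le {a c : B}
    (h : ∀ ε : ℝ, 0 < ε → ∃ a' : B, CuntzBelow a' c ∧ dist a' a ≤ ε) : CuntzBelow a c := by
  have key : ∀ n : ℕ, ∃ r : B, dist (r * c * star r) a < 2 * (1 / ((n : ℝ) + 1)) := by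
    intro n
    have hε : (0 : ℝ) < 1 / ((n : ℝ) + 1) := Nat.one_div_pos_of_nat
    obtain ⟨a', ⟨r, hr⟩, ha'⟩ := h _ hε
    obtain ⟨k, hk⟩ := ((Metric.tendsto_nhds.mp hr) _ hε).exists
    refine ⟨r k, (dist_triangle _ a' _).trans_lt ?_⟩
    linarith
  choose r hr using key
  refine ⟨r, tendsto_iff_dist_tendsto_zero.mpr ?_⟩
  refine squeeze_zero (fun _ => dist_nonneg) (fun n => (hr n).le) ?_
  simpa using (tendsto_one_div_add_atTop_nhds_zero_nat (𝕜 := ℝ)).const_mul 2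

end CStar

/-- Addition is jointly lower semicontinuous: to bound `z + t` it suffices to bound the sums
of elements way below `z` and `t`. -/
def CuDiv.AddContinuous (S : Type*) [CuSemigroup S] : Prop :=
  ∀ z t s : S, (∀ z' t' : S, WayBelow z' z → WayBelow t' t → z' + t' ≤ s) → z + t ≤ s

theorem IsCuntzSemigroupOf.addContinuous {A : Type*} [NonUnitalCStarAlgebra A] {S : Type*}
    [CuSemigroup S] (h : IsCuntzSemigroupOf A S) : CuDiv.AddContinuous S := by
  intro z t s hzt
  obtain ⟨a₀, ha₀, rfl⟩ := h.cls_surj z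
  obtain ⟨b₀, hb₀, rfl⟩ := h.cls_surj t
  obtain ⟨c, hc, rfl⟩ := h.cls_surj s
  obtain ⟨a, b, ha, hb, hab, haeq, hbeq⟩ := h.exists_orth a₀ b₀ ha₀ hb₀
  rw [← haeq, ← hbeq] at hzt ⊢
  have nonneg_add : ∀ {x y : h.stab}, CStarNonneg x → CStarNonneg y → CStarNonneg (x + y) := by
    let _ := CStarAlgebra.spectralOrder h.stab
    have := CStarAlgebra.spectralOrderedRing h.stab
    rintro _ _ ⟨p, rfl⟩ ⟨q, rfl⟩
    exact CStarAlgebra.nonneg_iff_eq_star_mul_self.mp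
      (add_nonneg (star_mul_self_nonneg p) (star_mul_self_nonneg q))
  rw [← h.cls_add_orth a b ha hb hab, h.cls_le_iff _ _ (nonneg_add ha hb) hc]
  refine CuntzBelow.of_forall_dist_le fun ε hε => ?_
  have hε2 : 0 < ε / 2 := half_pos hε
  have ha' := ha.cutdown hε2
  have hb' := hb.cutdown hε2
  refine ⟨_, (h.cls_le_iff _ _ (nonneg_add ha' hb') hc).mp ?_, ?_⟩
  · rw [h.cls_add_orth _ _ ha' hb' (ha.cutdown_mul_cutdown hb hab hε2)]
    exact hzt _ _ ((h.waybelow_iff _ a ha).mpr ⟨_, hε2, le_rfl⟩)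
      ((h.waybelow_iff _ b hb).mpr ⟨_, hε2, le_rfl⟩)
  · refine (dist_add_add_le _ _ _ _).trans ?_
    rw [dist_eq_norm, dist_eq_norm]
    linarith [ha.norm_cutdown_sub_le hε2, hb.norm_cutdown_sub_le hε2]

namespace CuDiv

variable {S : Type*} [CuSemigroup S]

open CuSemigroup

theorem exists_waybelow_between {x z : S} (h : WayBelow x z) :
    ∃ y, WayBelow x y ∧ WayBelow y z := by
  obtain ⟨f, hf, hff, hz⟩ := exists_waybelow_seq z
  obtain ⟨n, hn⟩ := h f hf z hz le_rfl
  exact ⟨f (n + 1), (hff n).of_le hn, (hff (n + 1)).trans_le (hz.1 ⟨_, rfl⟩)⟩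

theorem isLUB_add (hadd : AddContinuous S) {f g : ℕ → S} {y z : S} (hf : Monotone f)
    (hg : Monotone g) (hy : IsLUB (Set.range f) y) (hz : IsLUB (Set.range g) z) :
    IsLUB (Set.range fun i => f i + g i) (y + z) := by
  refine ⟨?_, fun s hs => hadd _ _ _ fun y' z' hy' hz' => ?_⟩
  · rintro _ ⟨i, rfl⟩
    exact add_le_add (hy.1 ⟨i, rfl⟩) (hz.1 ⟨i, rfl⟩)
  · obtain ⟨i, hi⟩ := hy' f hf y hy le_rfl
    obtain ⟨j, hj⟩ := hz' g hg z hz le_rfl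
    exact (add_le_add (hi.trans (hf (le_max_left i j))) (hj.trans (hg (le_max_right i j)))).trans
      (hs ⟨max i j, rfl⟩)

theorem isLUB_nsmul (hadd : AddContinuous S) {f : ℕ → S} {y : S} (hf : Monotone f)
    (hy : IsLUB (Set.range f) y) (N : ℕ) : IsLUB (Set.range fun i => N • f i) (N • y) := by
  induction N with
  | zero => simp
  | succ N ih =>
    simp only [succ_nsmul]
    exact isLUB_add hadd (fun i j h => nsmul_le_nsmul_right (hf h) N) hf ih hy

theorem exists_waybelow_of_waybelow_add (hadd : AddContinuous S) {u y z : S}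
    (h : WayBelow u (y + z)) : ∃ y' z', WayBelow y' y ∧ WayBelow z' z ∧ u ≤ y' + z' := by
  obtain ⟨f, hf, hff, hy⟩ := exists_waybelow_seq y
  obtain ⟨g, hg, hgg, hz⟩ := exists_waybelow_seq z
  obtain ⟨i, hi⟩ := h _ (fun i j h => add_le_add (hf h) (hg h)) _ (isLUB_add hadd hf hg hy hz) le_rfl
  exact ⟨f i, g i, (hff i).trans_le (hy.1 ⟨_, rfl⟩), (hgg i).trans_le (hz.1 ⟨_, rfl⟩), hi⟩

theorem exists_waybelow_of_waybelow_nsmul (hadd : AddContinuous S) {u y : S} {N : ℕ}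
    (h : WayBelow u (N • y)) : ∃ y', WayBelow y' y ∧ u ≤ N • y' := by
  obtain ⟨f, hf, hff, hy⟩ := exists_waybelow_seq y
  obtain ⟨i, hi⟩ := h _ (fun i j h => nsmul_le_nsmul_right (hf h) N) _ (isLUB_nsmul hadd hf hy N)
    le_rfl
  exact ⟨f i, (hff i).trans_le (hy.1 ⟨_, rfl⟩), hi⟩

theorem monotone_nsmul (t : S) : Monotone fun n : ℕ => n • t :=
  fun _ _ h => nsmul_le_nsmul_left (zero_le' t) h

theorem nsmul_le_infty (n : ℕ) (t : S) : n • t ≤ infty t :=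
  (isLUB_infty t).1 ⟨n, rfl⟩

theorem self_le_infty (t : S) : t ≤ infty t := by
  simpa using nsmul_le_infty 1 t

theorem add_le_infty (hadd : AddContinuous S) {a b t : S} (ha : a ≤ infty t) (hb : b ≤ infty t) :
    a + b ≤ infty t := by
  refine hadd _ _ _ fun a' b' ha' hb' => ?_
  obtain ⟨i, hi⟩ := ha' _ (monotone_nsmul t) _ (isLUB_infty t) ha
  obtain ⟨j, hj⟩ := hb' _ (monotone_nsmul t) _ (isLUB_infty t) hb
  exact (add_le_add hi hj).trans ((add_nsmul t i j).symm.le.trans (nsmul_le_infty _ t))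

theorem nsmul_le_infty_of_le (hadd : AddContinuous S) {a t : S} (ha : a ≤ infty t) (n : ℕ) :
    n • a ≤ infty t := by
  induction n with
  | zero => simpa using zero_le' (infty t)
  | succ n ih =>
    rw [succ_nsmul]
    exact add_le_infty hadd ih ha

theorem infty_le_infty_of_le (hadd : AddContinuous S) {a t : S} (ha : a ≤ infty t) :
    infty a ≤ infty t := by
  refine (isLUB_infty a).2 ?_
  rintro _ ⟨n, rfl⟩
  exact nsmul_le_infty_of_le hadd ha n

theorem StronglySoft.add_left (hadd : AddContinuous S) {s w : S} (hs : StronglySoft s)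
    (hw : w ≤ infty s) : StronglySoft (w + s) := by
  intro z hz
  obtain ⟨w', s', hw', hs', hle⟩ := exists_waybelow_of_waybelow_add hadd hz
  obtain ⟨t, ht, hst⟩ := hs s' hs'
  refine ⟨t, ?_, add_le_infty hadd (hw.trans (infty_le_infty_of_le hadd hst)) hst⟩
  calc z + t ≤ w' + s' + t := by gcongr
    _ = w' + (s' + t) := add_assoc _ _ _
    _ ≤ w + s := add_le_add hw'.le ht

theorem monotone_sum_range (e : ℕ → S) : Monotone fun n => ∑ i ∈ Finset.range n, e i :=
  monotone_nat_of_le_succ fun n => by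
    rw [Finset.sum_range_succ]
    exact le_add_of_nonneg_right (zero_le' _)

/-- The sum of a sequence in which each term is dominated by a multiple of its successor is
strongly soft. -/
theorem stronglySoft_of_isLUB_sum (hadd : AddContinuous S) {e : ℕ → S} {s : S}
    (he : ∀ k, ∃ N : ℕ, e k ≤ N • e (k + 1))
    (hs : IsLUB (Set.range fun n => ∑ i ∈ Finset.range n, e i) s) : StronglySoft s := by
  intro z hz
  obtain ⟨k, hk⟩ := hz _ (monotone_sum_range e) s hs le_rfl
  obtain ⟨t, ht⟩ := exists_isLUB _ (monotone_sum_range fun i => e (k + i))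
  refine ⟨t, hadd _ _ _ fun z' t' hz' ht' => ?_, hs.2 ?_⟩
  · obtain ⟨n, hn⟩ := ht' _ (monotone_sum_range fun i => e (k + i)) t ht le_rfl
    refine (add_le_add (hz'.le.trans hk) hn).trans ?_
    rw [← Finset.sum_range_add]
    exact hs.1 ⟨k + n, rfl⟩
  · have htail : ∀ j, e (k + j) ≤ infty t := fun j => by
      refine le_trans ?_ ((ht.1 ⟨j + 1, rfl⟩).trans (self_le_infty t))
      simp only [Finset.sum_range_succ]
      exact le_add_of_nonneg_left (Finset.sum_nonneg fun _ _ => zero_le' _)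
    have hall : ∀ d j, k ≤ j + d → e j ≤ infty t := by
      intro d
      induction d with
      | zero =>
        intro j hj
        obtain ⟨i, rfl⟩ := Nat.exists_eq_add_of_le hj
        exact htail i
      | succ d ih =>
        intro j hj
        obtain ⟨N, hN⟩ := he j
        exact hN.trans (nsmul_le_infty_of_le hadd (ih (j + 1) (by omega)) N)
    rintro _ ⟨n, rfl⟩
    refine Finset.sum_induction e (· ≤ infty t) (fun _ _ => add_le_infty hadd) (zero_le' _) ?_
    exact fun j _ => hall k j (Nat.le_add_left k j)

theorem GlobalGlimm.exists_half (hadd : AddContinuous S) (hG : GlobalGlimm S) {x' x : S}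
    (h : WayBelow x' x) :
    ∃ y' y : S, WayBelow y' y ∧ y + y ≤ x ∧ ∃ N : ℕ, x' ≤ N • y' := by
  obtain ⟨u, hu, hux⟩ := exists_waybelow_between h
  obtain ⟨y, N, huy, hyx⟩ := hG 2 x u hux
  obtain ⟨y', hy', hxy'⟩ := exists_waybelow_of_waybelow_nsmul hadd (hu.trans_le huy)
  exact ⟨y', y, hy', two_nsmul y ▸ hyx, N, hxy'⟩

/-- Under the Global Glimm Property there are strongly soft elements below `x` generating an
arbitrarily large part of the ideal generated by `x`. -/
theorem GlobalGlimm.exists_stronglySoft (hadd : AddContinuous S) (hG : GlobalGlimm S) {x' x : S}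
    (h : WayBelow x' x) : ∃ s : S, StronglySoft s ∧ s ≤ x ∧ x' ≤ infty s := by
  have step : ∀ p : {p : S × S // WayBelow p.1 p.2}, ∃ q : {p : S × S // WayBelow p.1 p.2},
      q.1.2 + q.1.2 ≤ p.1.2 ∧ ∃ N : ℕ, p.1.1 ≤ N • q.1.1 := by
    rintro ⟨⟨a', a⟩, ha⟩
    obtain ⟨b', b, hb, hba, hN⟩ := hG.exists_half hadd ha
    exact ⟨⟨⟨b', b⟩, hb⟩, hba, hN⟩
  choose next hnext hdom using step
  let p : ℕ → {p : S × S // WayBelow p.1 p.2} := fun n => next^[n] ⟨(x', x), h⟩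
  have hp : ∀ n, p (n + 1) = next (p n) := fun n => Function.iterate_succ_apply' _ _ _
  let e : ℕ → S := fun n => (p (n + 1)).1.1
  obtain ⟨s, hs⟩ := exists_isLUB _ (monotone_sum_range e)
  have hbound : ∀ n, ∑ i ∈ Finset.range n, e i + (p n).1.2 ≤ x := by
    intro n
    induction n with
    | zero => simp [p]
    | succ n ih =>
      refine le_trans ?_ ih
      rw [Finset.sum_range_succ, add_assoc]
      refine add_le_add le_rfl (le_trans ?_ (hnext (p n)))
      rw [← hp]
      exact add_le_add (p (n + 1)).2.le le_rfl
  refine ⟨s, stronglySoft_of_isLUB_sum hadd (fun k => ?_) hs, hs.2 ?_, ?_⟩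
  · simpa only [e, hp (k + 1)] using hdom (p (k + 1))
  · rintro _ ⟨n, rfl⟩
    exact (le_add_of_nonneg_right (zero_le' _)).trans (hbound n)
  · obtain ⟨N, hN⟩ := hdom (p 0)
    refine hN.trans ?_
    rw [← hp]
    refine (nsmul_le_nsmul_right (hs.1 ⟨1, ?_⟩) N).trans (nsmul_le_infty N s)
    simp [e]

/-- Under the Global Glimm Property, any `x' ≪ x` is bounded by the sum of an element that fits
twice into `x` and an element below a strongly soft element below `x`. -/
theorem GlobalGlimm.exists_le_half_add_soft (hadd : AddContinuous S) (hG : GlobalGlimm S)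
    {x' x : S} (h : WayBelow x' x) :
    ∃ y z : S, y + y ≤ x ∧ StronglySoft z ∧ z ≤ x ∧ x' ≤ y + z := by
  obtain ⟨u, hu, hux⟩ := exists_waybelow_between h
  obtain ⟨y', y, hy, hyx, N, huy⟩ := hG.exists_half hadd hux
  obtain ⟨y'', hy'', hyy⟩ := exists_waybelow_between hy
  obtain ⟨s, hsoft, hsy, hys⟩ := hG.exists_stronglySoft hadd hy''
  have hus : u ≤ infty s := huy.trans (nsmul_le_infty_of_le hadd hys N)
  have h0 : WayBelow (0 : S) 0 := fun f _ _ _ _ => ⟨0, zero_le' _⟩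
  have hyx' : y + 0 ≤ x := (add_le_add le_rfl (zero_le' y)).trans hyx
  obtain ⟨c, -, hsc, hxc⟩ := almost_algebraic s y 0 0 x (hyy.of_le hsy) h0 hyx'
  obtain ⟨v, w, -, hvy, hwu, hwc, hle⟩ := almost_riesz x' u y c hu (hux.le.trans hxc)
  refine ⟨y, w + s, hyx, hsoft.add_left hadd (hwu.trans hus), ?_, ?_⟩
  · rw [add_comm w s]
    exact (add_le_add le_rfl hwc).trans hsc
  · exact hle.trans (add_le_add hvy (le_add_of_nonneg_right (zero_le' s)))

theorem IsWeaklyDivisible.mono {m n n' : ℕ} {x : S} (h : IsWeaklyDivisible m n x) (hn : n ≤ n') :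
    IsWeaklyDivisible m n' x := by
  obtain ⟨k, rfl⟩ := Nat.exists_eq_add_of_le hn
  intro x' hx'
  obtain ⟨y, hy, hmy⟩ := h x' hx'
  refine ⟨Fin.append y fun _ => 0, by simpa [Fin.sum_univ_add] using hy, fun j => ?_⟩
  induction j using Fin.addCases with
  | left j => simpa using hmy j
  | right j => simpa using zero_le' x

theorem isWeaklyDivisible_of_wdiv_le {m n : ℕ} {x : S} (h : wdiv m x ≤ n) :
    IsWeaklyDivisible m n x := by
  have hne : {N : ℕ∞ | ∃ n : ℕ, 1 ≤ n ∧ N = n ∧ IsWeaklyDivisible m n x}.Nonempty := by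
    by_contra hempty
    rw [wdiv, Set.not_nonempty_iff_eq_empty.mp hempty, sInf_empty, top_le_iff] at h
    exact ENat.natCast_ne_top n h
  obtain ⟨k, -, hk, hdiv⟩ := csInf_mem hne
  refine hdiv.mono ?_
  rw [wdiv, hk] at h
  exact_mod_cast h

theorem wdiv_le {m n : ℕ} {x : S} (hn : 1 ≤ n) (h : IsWeaklyDivisible m n x) : wdiv m x ≤ n :=
  sInf_le ⟨n, hn, rfl, h⟩

theorem GlobalGlimm.isWeaklyDivisible_of_stronglySoft (hadd : AddContinuous S)
    (hG : GlobalGlimm S) {m n : ℕ}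
    (h : ∀ x : S, StronglySoft x → IsWeaklyDivisible (2 * m) n (m • x)) (x : S) :
    IsWeaklyDivisible (2 * m) (m + n) (m • x) := by
  intro x' hx'
  obtain ⟨u, hu, hux⟩ := exists_waybelow_between hx'
  obtain ⟨x₁, hx₁, hle⟩ := exists_waybelow_of_waybelow_nsmul hadd hux
  obtain ⟨y, z, hyx, hz, hzx, hxyz⟩ := hG.exists_le_half_add_soft hadd hx₁
  have hu' : WayBelow x' (m • y + m • z) := by
    rw [← nsmul_add]
    exact hu.trans_le (hle.trans (nsmul_le_nsmul_right hxyz m))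
  obtain ⟨p, q, hp, hq, hpq⟩ := exists_waybelow_of_waybelow_add hadd hu'
  obtain ⟨g, hqg, hg⟩ := h z hz q hq
  refine ⟨Fin.append (fun _ => y) g, ?_, fun j => ?_⟩
  · simpa [Fin.sum_univ_add] using hpq.trans (add_le_add hp.le hqg)
  · induction j using Fin.addCases with
    | left j =>
      rw [Fin.append_left, mul_comm, mul_nsmul', two_nsmul]
      exact nsmul_le_nsmul_right hyx m
    | right j =>
      rw [Fin.append_right]
      exact (hg j).trans (nsmul_le_nsmul_right hzx m)

end CuDiv

/-- Theorem 4.11.  For a C*-algebra with the Global Glimm Property,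
there is a uniform bound `wdiv_{2m}(m·x) ≤ n` over all `x ∈ Cu(A)` if and only if there
is such a bound over all strongly soft `x ∈ Cu(A)`. -/
theorem bounded_divisibility_iff_soft
    (A : Type) [NonUnitalCStarAlgebra A] (S : Type) [CuSemigroup S]
    (hS : IsCuntzSemigroupOf A S)
    (hggp : CuDiv.GlobalGlimm S) :
    (∃ m n : ℕ, 1 ≤ m ∧ ∀ x : S, CuDiv.wdiv (2 * m) (m • x) ≤ (n : ℕ∞)) ↔
      (∃ m n : ℕ, 1 ≤ m ∧
        ∀ x : S, CuDiv.StronglySoft x → CuDiv.wdiv (2 * m) (m • x) ≤ (n : ℕ∞)) := by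
  refine ⟨fun ⟨m, n, hm, h⟩ => ⟨m, n, hm, fun x _ => h x⟩, ?_⟩
  rintro ⟨m, n, hm, h⟩
  refine ⟨m, m + n, hm, fun x => CuDiv.wdiv_le (by omega) ?_⟩
  exact hggp.isWeaklyDivisible_of_stronglySoft hS.addContinuous
    (fun z hz => CuDiv.isWeaklyDivisible_of_wdiv_le (h z hz)) x
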